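/- arXiv:1801.02860 — 2 statements merged into one kernel-verified Lean document; each statement's English description precedes it below -/
import Mathlib

section
/- (Proposition 7) Let n ≥ 2, N = 2^n, let A ⊆ {0, ..., N−1} be domination-upward-closed, let D = { i ∈ {0, ..., N−1} : i ≡ 3 (mod 4) }, and let D_f = Ā ∩ D. Then the set C = A ∪ D_f is domination contiguous: for all h, j ∈ C and all i ∈ {0, ..., N−1}, if h ⪰ i and i ⪰ j then i ∈ C. -/
open Matrix

/-- The polar kernel `F = [[1,0],[1,1]]` over `GF(2)`. -/
def polarF : Matrix (Fin 2) (Fin 2) (ZMod 2) := !![1, 0; 1, 1]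

/-- The `n`-fold Kronecker power `G_N = F^{⊗ n}` over `GF(2)`,
indexed by `Fin (2 ^ n)` via the standard mixed-radix (binary) identification. -/
def polarG : (n : ℕ) → Matrix (Fin (2 ^ n)) (Fin (2 ^ n)) (ZMod 2)
  | 0 => 1
  | n + 1 =>
      Matrix.reindex
        (finProdFinEquiv.trans (finCongr (by rw [pow_succ, Nat.mul_comm])))
        (finProdFinEquiv.trans (finCongr (by rw [pow_succ, Nat.mul_comm])))
        (Matrix.kronecker polarF (polarG n))

/-- Binary domination `i ⪰ j` : every bit equal to 1 in `j` is also 1 in `i`. -/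
def Dominates (i j : ℕ) : Prop := ∀ t : ℕ, j.testBit t = true → i.testBit t = true

/-- `A` is domination-upward-closed. -/
def UpClosed {n : ℕ} (A : Finset (Fin (2 ^ n))) : Prop :=
  ∀ i ∈ A, ∀ j : Fin (2 ^ n), Dominates (j : ℕ) (i : ℕ) → j ∈ A

/-- The square submatrix `G_CC` of `G_N`, rows and columns indexed by the
elements of `C` listed in increasing order. -/
def subCC {n : ℕ} (C : Finset (Fin (2 ^ n))) :
    Matrix (Fin C.card) (Fin C.card) (ZMod 2) :=
  (polarG n).submatrix (⇑(C.orderEmbOfFin rfl)) (⇑(C.orderEmbOfFin rfl))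

/-- Every index dominating one congruent to `3` modulo `4` is itself congruent to `3` modulo `4`. -/
theorem Dominates.mod_four_eq_three {i j : ℕ} (hij : Dominates i j) (hj : j % 4 = 3) :
    i % 4 = 3 := by
  have h0 := hij 0
  have h1 := hij 1
  simp only [Nat.testBit_eq_decide_div_mod_eq, decide_eq_true_eq, pow_zero, pow_one] at h0 h1
  omega

/-- Proposition 7: with `A` domination-upward-closed,
`D = {i : i ≡ 3 (mod 4)}` and `D_f = Ā ∩ D`, the set `C = A ∪ D_f` is
domination contiguous. -/
theorem EPS_domination_contiguous (n : ℕ) (hn : 2 ≤ n)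
    (A : Finset (Fin (2 ^ n))) (hA : UpClosed A) :
    ∀ h ∈ A ∪ (Aᶜ ∩ Finset.univ.filter (fun i : Fin (2 ^ n) => (i : ℕ) % 4 = 3)),
      ∀ j ∈ A ∪ (Aᶜ ∩ Finset.univ.filter (fun i : Fin (2 ^ n) => (i : ℕ) % 4 = 3)),
        ∀ i : Fin (2 ^ n), Dominates (h : ℕ) (i : ℕ) → Dominates (i : ℕ) (j : ℕ) →
          i ∈ A ∪ (Aᶜ ∩ Finset.univ.filter (fun i : Fin (2 ^ n) => (i : ℕ) % 4 = 3)) := by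
  intro h _ j hj i _ hij
  simp only [Finset.mem_union, Finset.mem_inter, Finset.mem_compl, Finset.mem_filter,
    Finset.mem_univ, true_and] at hj ⊢
  by_cases hi : i ∈ A
  · exact Or.inl hi
  · rcases hj with hj | ⟨_, hj⟩
    · exact Or.inl (hA j hj i hij)
    · exact Or.inr ⟨hi, hij.mod_four_eq_three hj⟩
end

section
/- (Efficient encodability of UEPS) Let n ≥ 1, N = 2^n, let A ⊆ {0, ..., N−1} be domination-upward-closed, let S = { j ∈ Ā : the column of G_N indexed by j, restricted to the rows indexed by Ā, has exactly one nonzero entry (namely the entry in row j) }, let P_f ⊆ S, and let C = A ∪ P_f. Then the submatrix G_CC of G_N = F^{⊗n} satisfies G_CC · G_CC = I over GF(2), i.e., G_CC is its own inverse. -/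
open Matrix

theorem polarF_mul_self : polarF * polarF = 1 := by decide

theorem le_of_polarF_ne_zero {a b : Fin 2} (h : polarF a b ≠ 0) : b ≤ a := by
  fin_cases a <;> fin_cases b <;> simp_all [polarF]

theorem polarG_mul_self (n : ℕ) : polarG n * polarG n = 1 := by
  induction n with
  | zero => exact one_mul 1
  | succ n ih =>
    simp only [polarG, Matrix.reindex_apply, Matrix.submatrix_mul_equiv]
    rw [Matrix.kronecker, ← Matrix.mul_kronecker_mul, polarF_mul_self, ih, Matrix.one_kronecker_one,
      Matrix.submatrix_one_equiv]

theorem dominates_two_pow_mul_add {n a b x y : ℕ} (hx : x < 2 ^ n) (hy : y < 2 ^ n)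
    (hab : Dominates a b) (hxy : Dominates x y) :
    Dominates (2 ^ n * a + x) (2 ^ n * b + y) := by
  intro t
  rw [Nat.testBit_two_pow_mul_add b hy, Nat.testBit_two_pow_mul_add a hx]
  split_ifs
  · exact hxy t
  · exact hab (t - n)

theorem dominates_of_le_of_lt_two {a b : ℕ} (ha : a < 2) (h : b ≤ a) : Dominates a b := by
  intro t
  interval_cases a <;> interval_cases b <;> simp

theorem dominates_of_polarG_ne_zero {n : ℕ} {i j : Fin (2 ^ n)} (h : polarG n i j ≠ 0) :
    Dominates i j := by
  induction n with
  | zero =>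
    obtain rfl : i = j := Subsingleton.elim (α := Fin 1) i j
    exact fun _ => id
  | succ n ih =>
    let e : Fin 2 × Fin (2 ^ n) ≃ Fin (2 ^ (n + 1)) :=
      finProdFinEquiv.trans (finCongr (by rw [pow_succ, Nat.mul_comm]))
    have he (p : Fin 2 × Fin (2 ^ n)) : (e p : ℕ) = 2 ^ n * p.1 + p.2 := by
      simp [e, finProdFinEquiv, Nat.add_comm]
    obtain ⟨p, rfl⟩ := e.surjective i
    obtain ⟨q, rfl⟩ := e.surjective j
    have hpq : polarG (n + 1) (e p) (e q) = polarF p.1 q.1 * polarG n p.2 q.2 := by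
      change Matrix.kronecker polarF (polarG n) (e.symm (e p)) (e.symm (e q)) = _
      simp only [Equiv.symm_apply_apply]
      rfl
    rw [hpq] at h
    rw [he, he]
    exact dominates_two_pow_mul_add p.2.isLt q.2.isLt
      (dominates_of_le_of_lt_two p.1.isLt (le_of_polarF_ne_zero (left_ne_zero_of_mul h)))
      (ih (right_ne_zero_of_mul h))

/-- If the columns in `C` vanish on all rows outside `C`, then the `C`-block of the
involution `polarG n` is an involution. -/
theorem subCC_mul_self {n : ℕ} {C : Finset (Fin (2 ^ n))}
    (hC : ∀ j ∈ C, ∀ k, polarG n k j ≠ 0 → k ∈ C) : subCC C * subCC C = 1 := by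
  ext a b
  let f := C.orderEmbOfFin rfl
  have hsum : ∑ c, polarG n (f a) (f c) * polarG n (f c) (f b) =
      ∑ k, polarG n (f a) k * polarG n k (f b) := by
    refine Finset.sum_of_injOn f f.injective.injOn (fun _ _ => Finset.mem_coe.2 (Finset.mem_univ _))
      (fun k _ hk => ?_) (fun _ _ => rfl)
    by_contra h
    have hkC := hC (f b) (C.orderEmbOfFin_mem rfl b) k (right_ne_zero_of_mul h)
    rw [← Finset.mem_coe, ← C.range_orderEmbOfFin rfl] at hkC
    obtain ⟨c, rfl⟩ := hkC
    exact hk ⟨c, Finset.mem_coe.2 (Finset.mem_univ c), rfl⟩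
  calc (subCC C * subCC C) a b = (polarG n * polarG n) (f a) (f b) := hsum
    _ = (1 : Matrix (Fin C.card) (Fin C.card) (ZMod 2)) a b := by
      rw [polarG_mul_self, Matrix.one_apply, Matrix.one_apply]
      simp only [f.injective.eq_iff]

/-- efficient encodability of UEPS: with `A` domination-upward-closed,
`S` the set of columns in `Ā` whose restriction to rows `Ā` has exactly one nonzero
entry (in row `j` itself), `P_f ⊆ S` and `C = A ∪ P_f`, the submatrix `G_CC` is its own
inverse over `GF(2)`. -/
theorem UEPS_subCC_involution (n : ℕ) (hn : 1 ≤ n)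
    (A S Pf : Finset (Fin (2 ^ n))) (hA : UpClosed A)
    (hS : ∀ j : Fin (2 ^ n),
      j ∈ S ↔ (j ∈ Aᶜ ∧ ∀ i ∈ Aᶜ, (polarG n i j ≠ 0 ↔ i = j)))
    (hPf : Pf ⊆ S) :
    subCC (A ∪ Pf) * subCC (A ∪ Pf) = 1 := by
  refine subCC_mul_self fun j hj k hkj => ?_
  by_cases hkA : k ∈ A
  · exact Finset.mem_union_left _ hkA
  rcases Finset.mem_union.1 hj with hjA | hjP
  · exact absurd (hA j hjA k (dominates_of_polarG_ne_zero hkj)) hkA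
  · obtain rfl := (((hS j).1 (hPf hjP)).2 k (Finset.mem_compl.2 hkA)).1 hkj
    exact hj
end
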